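/- Let F : ℝ^m → ℝ^m be L-Lipschitz and r : ℝ^m → ℝ ∪ {+∞} proper, convex and lower semicontinuous. Consider one deterministic FBFp step: w_k = prox_{α_k r}(z_k − α_k F(w_{k−1})), z_{k+1} = w_k + α_k (F(w_{k−1}) − F(w_k)). Then for every z ∈ ℝ^m: α_k g(w_k,z) + ½ ‖z_{k+1} − z‖² ≤ ½ ‖z_k − z‖² − ½ ‖z_k − w_k‖² + ½ α_k² L² ‖w_{k−1} − w_k‖², where g(w,z) := ⟨F(w), w−z⟩ + r(w) − r(z). -/

import Mathlib

open scoped RealInnerProductSpace ENNReal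
open MeasureTheory ProbabilityTheory

noncomputable section

/-- A monotone operator on a real inner product space. -/
def MonotoneOp {E : Type*} [NormedAddCommGroup E] [InnerProductSpace ℝ E]
    (F : E → E) : Prop :=
  ∀ z z' : E, 0 ≤ ⟪F z - F z', z - z'⟫

/-- An `L`-Lipschitz operator. -/
def LipschitzOp {E : Type*} [NormedAddCommGroup E] (L : ℝ) (F : E → E) : Prop :=
  ∀ z z' : E, ‖F z - F z'‖ ≤ L * ‖z - z'‖

/-- A proper function with values in `ℝ ∪ {+∞}`: it never takes the value `-∞`
and is finite somewhere. -/
def ProperFn {E : Type*} (r : E → EReal) : Prop :=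
  (∀ w, r w ≠ ⊥) ∧ (∃ w, r w ≠ ⊤)

/-- Convexity of an extended-real-valued function. -/
def ConvexFn {E : Type*} [AddCommMonoid E] [Module ℝ E] (r : E → EReal) : Prop :=
  ∀ x y : E, ∀ a b : ℝ, 0 ≤ a → 0 ≤ b → a + b = 1 →
    r (a • x + b • y) ≤ (a : EReal) * r x + (b : EReal) * r y

/-- `p` is the proximal point `prox_{lam·r}(x)`, i.e. a minimizer of
`w' ↦ r(w') + (1/(2·lam))‖w' - x‖²`. -/
def IsProxPt {E : Type*} [NormedAddCommGroup E] (r : E → EReal) (lam : ℝ)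
    (x p : E) : Prop :=
  ∀ q : E, r p + (((2 * lam)⁻¹ * ‖p - x‖ ^ 2 : ℝ) : EReal)
    ≤ r q + (((2 * lam)⁻¹ * ‖q - x‖ ^ 2 : ℝ) : EReal)

/-- One term `⟨F(z), w - z⟩ + r(w) - r(z)` of the restricted gap function,
with the convention that `∞ - ∞` is interpreted as `+∞`. -/
def gapTerm {E : Type*} [NormedAddCommGroup E] [InnerProductSpace ℝ E]
    (F : E → E) (r : E → EReal) (w z : E) : EReal :=
  if r w = ⊤ ∧ r z = ⊤ then ⊤
  else ((⟪F z, w - z⟫ : ℝ) : EReal) + r w - r z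

/-- The restricted gap function `G_B(w) = sup_{z ∈ B} ⟨F(z), w - z⟩ + r(w) - r(z)`. -/
def gapFn {E : Type*} [NormedAddCommGroup E] [InnerProductSpace ℝ E]
    (F : E → E) (r : E → EReal) (B : Set E) (w : E) : EReal :=
  ⨆ z ∈ B, gapTerm F r w z

/-- The quantity `g(w,z) = ⟨F(w), w - z⟩ + r(w) - r(z)` associated to the strong
variational inequality. -/
def gFn {E : Type*} [NormedAddCommGroup E] [InnerProductSpace ℝ E]
    (F : E → E) (r : E → EReal) (w z : E) : EReal :=
  ((⟪F w, w - z⟫ : ℝ) : EReal) + r w - r z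

/-- `w` solves the monotone inclusion `0 ∈ F(w) + ∂r(w)`, i.e. `-F(w) ∈ ∂r(w)`. -/
def SolvesInclusion {E : Type*} [NormedAddCommGroup E] [InnerProductSpace ℝ E]
    (F : E → E) (r : E → EReal) (w : E) : Prop :=
  ∀ w' : E, ((⟪-F w, w' - w⟫ : ℝ) : EReal) + r w ≤ r w'

/-- The positive part of an extended real number, as an element of `ℝ≥0∞`. -/
def erealPosPart (x : EReal) : ℝ≥0∞ :=
  if x = ⊤ then ⊤ else ENNReal.ofReal x.toReal

/-- The expectation of an extended-real-valued random variable: the difference of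
the (unsigned) integrals of its positive and negative parts. -/
def erealExp {Ω : Type*} [MeasurableSpace Ω] (μ : Measure Ω) (X : Ω → EReal) : EReal :=
  ((∫⁻ ω, erealPosPart (X ω) ∂μ : ℝ≥0∞) : EReal)
    - ((∫⁻ ω, erealPosPart (-(X ω)) ∂μ : ℝ≥0∞) : EReal)

/-- The weighted average `w̄_K = (∑_{k<K} α_k w_k) / (∑_{k<K} α_k)`. -/
def avgIter {E : Type*} [AddCommGroup E] [Module ℝ E] (α : ℕ → ℝ) (w : ℕ → E)
    (K : ℕ) : E :=
  (∑ k ∈ Finset.range K, α k)⁻¹ • ∑ k ∈ Finset.range K, α k • w k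

end

/-- A real number bounded by `t * K` for all `t ∈ (0, 1]` is nonpositive. -/
lemma nonpos_of_forall_le_mul {D K : ℝ} (hK : 0 ≤ K)
    (h : ∀ t : ℝ, 0 < t → t ≤ 1 → D ≤ t * K) : D ≤ 0 := by
  by_contra! hD
  have hDK : 0 < D + K := by linarith
  have ht := h (D / (D + K)) (by positivity) ((div_le_one hDK).2 (by linarith))
  rw [div_mul_eq_mul_div, le_div_iff₀ hDK] at ht
  nlinarith [mul_pos hD hD]

/-- A proximal point of a proper function lies in its effective domain. -/
lemma IsProxPt.ne_top {E : Type*} [NormedAddCommGroup E] {r : E → EReal} {lam : ℝ}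
    {x p : E} (hp : IsProxPt r lam x p) (hr : ProperFn r) : r p ≠ ⊤ := by
  obtain ⟨q, hq⟩ := hr.2
  intro hpt
  have h := hp q
  lift r q to ℝ using ⟨hq, hr.1 q⟩ with b
  rw [hpt, EReal.top_add_coe, ← EReal.coe_add, top_le_iff] at h
  exact EReal.coe_ne_top _ h

/-- The variational inequality characterizing a proximal point `p` of a convex function,
tested against a point `q` of the effective domain. -/
lemma IsProxPt.mul_sub_le_inner {E : Type*} [NormedAddCommGroup E] [InnerProductSpace ℝ E]
    {r : E → EReal} {lam : ℝ} {x p q : E} (hp : IsProxPt r lam x p) (hr : ConvexFn r)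
    (hlam : 0 < lam) {a b : ℝ} (ha : r p = a) (hb : r q = b) :
    lam * (a - b) ≤ ⟪p - x, q - p⟫ := by
  suffices h : lam * (a - b) - ⟪p - x, q - p⟫ ≤ 0 by linarith
  refine nonpos_of_forall_le_mul (K := 2⁻¹ * ‖q - p‖ ^ 2) (by positivity) fun t ht ht1 => ?_
  have hconv := hr p q (1 - t) t (by linarith) ht.le (by ring)
  have hmin := (hp ((1 - t) • p + t • q)).trans (add_le_add_left hconv _)
  rw [ha, hb] at hmin
  norm_cast at hmin
  have hvec : (1 - t) • p + t • q - x = (p - x) + t • (q - p) := by module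
  rw [hvec, norm_add_sq_real, norm_smul, inner_smul_right, Real.norm_of_nonneg ht.le] at hmin
  have hscaled := mul_le_mul_of_nonneg_left hmin hlam.le
  have hcancel : lam * (2 * lam)⁻¹ = 2⁻¹ := by field_simp
  have hexpand : ∀ u v : ℝ, lam * (u + (2 * lam)⁻¹ * v) = lam * u + 2⁻¹ * v := fun u v => by
    rw [← hcancel]; ring
  rw [hexpand, hexpand] at hscaled
  refine le_of_mul_le_mul_left ?_ ht
  linarith

/-- The algebraic identity behind the forward-backward-forward step. -/
lemma inner_add_half_norm_sq_fbf {E : Type*} [NormedAddCommGroup E] [InnerProductSpace ℝ E]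
    (c : ℝ) (u v y w z : E) :
    ⟪w - (y - c • u), z - w⟫ + c * ⟪v, w - z⟫ + 2⁻¹ * ‖w + c • (u - v) - z‖ ^ 2
      = 2⁻¹ * ‖y - z‖ ^ 2 - 2⁻¹ * ‖y - w‖ ^ 2 + 2⁻¹ * c ^ 2 * ‖u - v‖ ^ 2 := by
  have h₁ : w + c • (u - v) - z = (w - z) + c • (u - v) := by abel
  have h₂ : y - z = (y - w) + (w - z) := by abel
  have h₃ : w - (y - c • u) = c • u - (y - w) := by abel
  have h₄ : z - w = -(w - z) := by abel
  rw [h₁, h₂, h₃, h₄, norm_add_sq_real, norm_add_sq_real, norm_smul, mul_pow,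
    Real.norm_eq_abs, sq_abs, inner_neg_right, inner_sub_left, inner_smul_left,
    inner_smul_right, real_inner_comm (u - v), inner_sub_left u v]
  simp only [conj_trivial]
  ring

/-- deterministic FBFp one-step estimate.
One FBFp step `w_k = prox_{α_k r}(z_k - α_k F(w_{k-1}))`,
`z_{k+1} = w_k + α_k (F(w_{k-1}) - F(w_k))` satisfies, for every `z`:
`α_k g(w_k,z) + ½‖z_{k+1}-z‖² ≤ ½‖z_k-z‖² - ½‖z_k-w_k‖² + ½α_k²L²‖w_{k-1}-w_k‖²`.
Here `wkm` denotes `w_{k-1}`. -/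
theorem fbfp_one_step {m : ℕ}
    (F : EuclideanSpace ℝ (Fin m) → EuclideanSpace ℝ (Fin m)) (L : ℝ) (hL : 0 < L)
    (hlip : LipschitzOp L F)
    (r : EuclideanSpace ℝ (Fin m) → EReal)
    (hproper : ProperFn r) (hconv : ConvexFn r) (hlsc : LowerSemicontinuous r)
    (αk : ℝ) (hαk : 0 < αk)
    (zk wk zk1 wkm : EuclideanSpace ℝ (Fin m))
    (hw : IsProxPt r αk (zk - αk • F wkm) wk)
    (hz : zk1 = wk + αk • (F wkm - F wk))
    (z : EuclideanSpace ℝ (Fin m)) :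
    (αk : EReal) * gFn F r wk z + (((2 : ℝ)⁻¹ * ‖zk1 - z‖ ^ 2 : ℝ) : EReal)
      ≤ (((2 : ℝ)⁻¹ * ‖zk - z‖ ^ 2 - (2 : ℝ)⁻¹ * ‖zk - wk‖ ^ 2
          + (2 : ℝ)⁻¹ * αk ^ 2 * L ^ 2 * ‖wkm - wk‖ ^ 2 : ℝ) : EReal) := by
  have hwk : r wk ≠ ⊤ := hw.ne_top hproper
  obtain ⟨a, ha⟩ : ∃ a : ℝ, r wk = a := ⟨_, (EReal.coe_toReal hwk (hproper.1 wk)).symm⟩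
  by_cases hzt : r z = ⊤
  · rw [gFn, ha, hzt, ← EReal.coe_add, EReal.sub_top, EReal.coe_mul_bot_of_pos hαk,
      EReal.bot_add]
    exact bot_le
  obtain ⟨b, hb⟩ : ∃ b : ℝ, r z = b := ⟨_, (EReal.coe_toReal hzt (hproper.1 z)).symm⟩
  rw [gFn, ha, hb]
  norm_cast
  have hprox := hw.mul_sub_le_inner hconv hαk ha hb
  have hid := inner_add_half_norm_sq_fbf αk (F wkm) (F wk) zk wk z
  have hF : ‖F wkm - F wk‖ ^ 2 ≤ L ^ 2 * ‖wkm - wk‖ ^ 2 := by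
    rw [← mul_pow]
    exact pow_le_pow_left₀ (norm_nonneg _) (hlip wkm wk) 2
  have hFα := mul_le_mul_of_nonneg_left hF (by positivity : 0 ≤ 2⁻¹ * αk ^ 2)
  rw [hz]
  linarith
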